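/- Under the assumptions of the gradient-covariance lemma, if the predicted generating function satisfies |Dψ^f| = 1 almost surely (Huygens' principle / eikonal condition), then E[|Dψ^a|²] = 1 − tr(D (M C_ψψ^f)ᵀ [C_εε + M C_ψψ^f Mᵀ]^{-1} M C_ψψ^f Dᵀ) ≤ 1. -/

import Mathlib

open MeasureTheory Matrix

/-- Kalman gain `K = (M Cf)ᵀ [Ce + M Cf Mᵀ]⁻¹`. -/
noncomputable def kalmanGain {n m : ℕ} (M : Matrix (Fin m) (Fin n) ℝ)
    (Cf : Matrix (Fin n) (Fin n) ℝ) (Ce : Matrix (Fin m) (Fin m) ℝ) :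
    Matrix (Fin n) (Fin m) ℝ :=
  (M * Cf)ᵀ * (Ce + M * Cf * Mᵀ)⁻¹

/-- Filtered state `ψᵃ = ψᶠ + K (y - M ψᶠ)`. -/
noncomputable def filteredState {n m : ℕ} (M : Matrix (Fin m) (Fin n) ℝ)
    (Cf : Matrix (Fin n) (Fin n) ℝ) (Ce : Matrix (Fin m) (Fin m) ℝ)
    (ψf : Fin n → ℝ) (y : Fin m → ℝ) : Fin n → ℝ :=
  ψf + (kalmanGain M Cf Ce).mulVec (y - M.mulVec ψf)


/-- `u`, `v` have integrable products with second-moment matrix `C`. -/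
def HasMom {Ω : Type*} [MeasurableSpace Ω] (P : Measure Ω) {a b : ℕ}
    (u : Ω → Fin a → ℝ) (v : Ω → Fin b → ℝ) (C : Matrix (Fin a) (Fin b) ℝ) : Prop :=
  ∀ i j, Integrable (fun ω => u ω i * v ω j) P ∧ ∫ ω, u ω i * v ω j ∂P = C i j

theorem HasMom.symm {Ω : Type*} [MeasurableSpace Ω] {P : Measure Ω} {a b : ℕ}
    {u : Ω → Fin a → ℝ} {v : Ω → Fin b → ℝ} {C : Matrix (Fin a) (Fin b) ℝ}
    (h : HasMom P u v C) : HasMom P v u Cᵀ := by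
  intro i j
  have := h j i
  simpa only [mul_comm, Matrix.transpose_apply] using this

theorem HasMom.mulVec_left {Ω : Type*} [MeasurableSpace Ω] {P : Measure Ω} {a b c : ℕ}
    {u : Ω → Fin a → ℝ} {v : Ω → Fin b → ℝ} {C : Matrix (Fin a) (Fin b) ℝ}
    (h : HasMom P u v C) (A : Matrix (Fin c) (Fin a) ℝ) :
    HasMom P (fun ω => A.mulVec (u ω)) v (A * C) := by
  intro i j
  have e : (fun ω => A.mulVec (u ω) i * v ω j)
      = fun ω => ∑ k, A i k * (u ω k * v ω j) := by
    funext ω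
    simp only [Matrix.mulVec, dotProduct, Finset.sum_mul, mul_assoc]
  have hi : ∀ k ∈ Finset.univ, Integrable (fun ω => A i k * (u ω k * v ω j)) P :=
    fun k _ => (h k j).1.const_mul _
  rw [e]
  refine ⟨integrable_finsetSum _ hi, ?_⟩
  rw [integral_finsetSum _ hi, Matrix.mul_apply]
  refine Finset.sum_congr rfl fun k _ => ?_
  rw [integral_const_mul, (h k j).2]

theorem HasMom.mulVec_right {Ω : Type*} [MeasurableSpace Ω] {P : Measure Ω} {a b c : ℕ}
    {u : Ω → Fin a → ℝ} {v : Ω → Fin b → ℝ} {C : Matrix (Fin a) (Fin b) ℝ}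
    (h : HasMom P u v C) (B : Matrix (Fin c) (Fin b) ℝ) :
    HasMom P u (fun ω => B.mulVec (v ω)) (C * Bᵀ) := by
  have := (h.symm.mulVec_left B).symm
  rwa [Matrix.transpose_mul, Matrix.transpose_transpose] at this

theorem HasMom.sub_left {Ω : Type*} [MeasurableSpace Ω] {P : Measure Ω} {a b : ℕ}
    {u u' : Ω → Fin a → ℝ} {v : Ω → Fin b → ℝ} {C C' : Matrix (Fin a) (Fin b) ℝ}
    (h : HasMom P u v C) (h' : HasMom P u' v C') :
    HasMom P (fun ω => u ω - u' ω) v (C - C') := by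
  intro i j
  simp only [Pi.sub_apply, sub_mul, Matrix.sub_apply]
  exact ⟨(h i j).1.sub (h' i j).1, by
    rw [integral_sub (h i j).1 (h' i j).1, (h i j).2, (h' i j).2]⟩

theorem HasMom.sub_right {Ω : Type*} [MeasurableSpace Ω] {P : Measure Ω} {a b : ℕ}
    {u : Ω → Fin a → ℝ} {v v' : Ω → Fin b → ℝ} {C C' : Matrix (Fin a) (Fin b) ℝ}
    (h : HasMom P u v C) (h' : HasMom P u v' C') :
    HasMom P u (fun ω => v ω - v' ω) (C - C') := by
  have := (h.symm.sub_left h'.symm).symm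
  rwa [Matrix.transpose_sub, Matrix.transpose_transpose, Matrix.transpose_transpose] at this

theorem HasMom.trace {Ω : Type*} [MeasurableSpace Ω] {P : Measure Ω} {a : ℕ}
    {u v : Ω → Fin a → ℝ} {C : Matrix (Fin a) (Fin a) ℝ}
    (h : HasMom P u v C) : Integrable (fun ω => ∑ i, u ω i * v ω i) P ∧
      ∫ ω, ∑ i, u ω i * v ω i ∂P = C.trace := by
  refine ⟨integrable_finsetSum _ fun i _ => (h i i).1, ?_⟩
  rw [integral_finsetSum _ fun i _ => (h i i).1]
  exact Finset.sum_congr rfl fun i _ => (h i i).2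

/-- If the predicted generating function satisfies the eikonal condition `|Dψᶠ| = 1`
almost surely, then the Kalman-filtered state satisfies
`E[|Dψᵃ|²] = 1 - tr(D (M Cf)ᵀ [Ce + M Cf Mᵀ]⁻¹ M Cf Dᵀ) ≤ 1`. -/
theorem filtered_expected_slope_sq
    {n m p : ℕ} {Ω : Type*} [MeasurableSpace Ω] (P : Measure Ω) [IsProbabilityMeasure P]
    (ψf : Ω → Fin n → ℝ) (εv : Ω → Fin m → ℝ) (x : Fin n → ℝ)
    (M : Matrix (Fin m) (Fin n) ℝ) (Cf : Matrix (Fin n) (Fin n) ℝ)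
    (Ce : Matrix (Fin m) (Fin m) ℝ) (D : Matrix (Fin p) (Fin n) ℝ)
    (hCfSym : Cf.PosSemidef) (hCePD : Ce.PosDef)
    (hiff : ∀ i j, Integrable (fun ω => ψf ω i * ψf ω j) P)
    (hife : ∀ i j, Integrable (fun ω => ψf ω i * εv ω j) P)
    (hiee : ∀ i j, Integrable (fun ω => εv ω i * εv ω j) P)
    (hif : ∀ i, Integrable (fun ω => ψf ω i) P)
    (hie : ∀ i, Integrable (fun ω => εv ω i) P)
    (hCf : ∀ i j, ∫ ω, (ψf ω i - x i) * (ψf ω j - x j) ∂P = Cf i j)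
    (hCe : ∀ i j, ∫ ω, εv ω i * εv ω j ∂P = Ce i j)
    (hcross : ∀ i j, ∫ ω, (ψf ω i - x i) * εv ω j ∂P = 0)
    (hmean_e : ∀ i, ∫ ω, εv ω i ∂P = 0)
    (hmean_f : ∀ i, ∫ ω, ψf ω i ∂P = x i)
    (heik : ∀ᵐ ω ∂P, ∑ i, (D.mulVec (ψf ω) i) ^ 2 = 1) :
    (∫ ω, ∑ i, (D.mulVec (filteredState M Cf Ce (ψf ω) (M.mulVec x + εv ω)) i) ^ 2 ∂P
        = 1 - (D * (M * Cf)ᵀ * (Ce + M * Cf * Mᵀ)⁻¹ * (M * Cf) * Dᵀ).trace) ∧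
    (∫ ω, ∑ i, (D.mulVec (filteredState M Cf Ce (ψf ω) (M.mulVec x + εv ω)) i) ^ 2 ∂P
        ≤ 1) := by
  have hSym : Cfᵀ = Cf := by
    simpa [Matrix.conjTranspose_eq_transpose_of_trivial] using hCfSym.isHermitian.eq
  have hMCM : (M * Cf * Mᵀ).PosSemidef := by
    simpa [Matrix.conjTranspose_eq_transpose_of_trivial] using
      hCfSym.mul_mul_conjTranspose_same M
  have hS : (Ce + M * Cf * Mᵀ).PosDef := hCePD.add_posSemidef hMCM
  have hfe : HasMom P (fun ω => ψf ω - x) εv 0 := fun i j =>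
    ⟨((hife i j).sub ((hie j).const_mul (x i))).congr
      (Filter.Eventually.of_forall fun ω => by simp [sub_mul]),
      by simpa using hcross i j⟩
  have hee : HasMom P εv εv Ce := fun i j => ⟨hiee i j, hCe i j⟩
  have hψe : HasMom P ψf εv 0 := fun i j => by
    refine ⟨hife i j, ?_⟩
    have h := hcross i j
    simp only [sub_mul] at h
    rw [integral_sub (hife i j) ((hie j).const_mul _), integral_const_mul, hmean_e] at h
    simpa using h
  have hif' : ∀ i, Integrable (fun ω => ψf ω i - x i) P :=
    fun i => (hif i).sub (integrable_const _)
  have hψψ : HasMom P ψf (fun ω => ψf ω - x) Cf := fun i j => by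
    have hI : Integrable (fun ω => ψf ω i * (ψf ω j - x j)) P :=
      ((hiff i j).sub ((hif i).mul_const (x j))).congr
        (Filter.Eventually.of_forall fun ω => by simp [mul_sub])
    refine ⟨hI, ?_⟩
    have h := hCf i j
    simp only [sub_mul (ψf _ i)] at h
    rw [integral_sub hI ((hif' j).const_mul _), integral_const_mul,
      integral_sub (hif j) (integrable_const _), hmean_f] at h
    simpa using h
  have hff : HasMom P (fun ω => ψf ω - x) (fun ω => ψf ω - x) Cf := fun i j => by
    refine ⟨?_, hCf i j⟩
    have := (hψψ i j).1.sub ((hif' j).const_mul (x i))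
    refine this.congr (Filter.Eventually.of_forall fun ω => ?_)
    simp [sub_mul]
  -- the innovation
  let d : Ω → Fin m → ℝ := fun ω => εv ω - M.mulVec (ψf ω - x)
  have hψd : HasMom P ψf d (0 - Cf * Mᵀ) := hψe.sub_right (hψψ.mulVec_right M)
  have hdd : HasMom P d d (Ce + M * Cf * Mᵀ) := by
    have h1 : HasMom P εv d (Ce - (0 : Matrix (Fin n) (Fin m) ℝ)ᵀ * Mᵀ) := hee.sub_right (hfe.symm.mulVec_right M)
    have h2 : HasMom P (fun ω => M.mulVec (ψf ω - x)) d (M * (0 - Cf * Mᵀ)) :=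
      (hfe.sub_right (hff.mulVec_right M)).mulVec_left M
    have h3 := h1.sub_left h2
    have e : Ce - (0 : Matrix (Fin n) (Fin m) ℝ)ᵀ * Mᵀ - M * (0 - Cf * Mᵀ) = Ce + M * Cf * Mᵀ := by
      rw [Matrix.transpose_zero, Matrix.zero_mul, zero_sub, Matrix.mul_neg, sub_zero,
        sub_neg_eq_add, Matrix.mul_assoc]
    rwa [e] at h3
  generalize hSdef : Ce + M * Cf * Mᵀ = S at *
  have hST : Sᵀ = S := by
    simpa [Matrix.conjTranspose_eq_transpose_of_trivial] using hS.isHermitian.eq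
  have hSu : IsUnit S.det := (Matrix.isUnit_iff_isUnit_det _).1 hS.isUnit
  set K := kalmanGain M Cf Ce with hK
  have hK' : K = (M * Cf)ᵀ * S⁻¹ := by rw [hK, kalmanGain, hSdef]
  have hKT : Kᵀ = S⁻¹ * (M * Cf) := by
    rw [hK', Matrix.transpose_mul, Matrix.transpose_transpose, Matrix.transpose_nonsing_inv, hST]
  have hcr := ((hψd.mulVec_left D).mulVec_right (D * K)).trace
  have hsq := ((hdd.mulVec_left (D * K)).mulVec_right (D * K)).trace
  have hpt : ∀ ω, D.mulVec (filteredState M Cf Ce (ψf ω) (M.mulVec x + εv ω))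
      = D.mulVec (ψf ω) + (D * K).mulVec (d ω) := by
    intro ω
    have : M.mulVec x + εv ω - M.mulVec (ψf ω) = d ω := by
      simp only [d, Matrix.mulVec_sub]; abel
    rw [filteredState, this, Matrix.mulVec_add, Matrix.mulVec_mulVec]
  have hint : ∫ ω, ∑ i, (D.mulVec (filteredState M Cf Ce (ψf ω) (M.mulVec x + εv ω)) i) ^ 2 ∂P
      = ∫ ω, (1 + 2 * (∑ i, D.mulVec (ψf ω) i * (D * K).mulVec (d ω) i))
        + ∑ i, (D * K).mulVec (d ω) i * (D * K).mulVec (d ω) i ∂P := by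
    refine integral_congr_ae ?_
    filter_upwards [heik] with ω hω
    rw [← hω, hpt, Finset.mul_sum, ← Finset.sum_add_distrib, ← Finset.sum_add_distrib]
    refine Finset.sum_congr rfl fun i _ => ?_
    rw [Pi.add_apply]; ring
  have hc2 := hcr.1.const_mul 2
  have hT : D * (M * Cf)ᵀ * S⁻¹ * (M * Cf) * Dᵀ = (D * (M * Cf)ᵀ) * S⁻¹ * (D * (M * Cf)ᵀ)ᵀ := by
    simp only [Matrix.transpose_mul, Matrix.transpose_transpose, Matrix.mul_assoc]
  have e1 : D * (0 - Cf * Mᵀ) * (D * K)ᵀ = -(D * (M * Cf)ᵀ * S⁻¹ * (M * Cf) * Dᵀ) := by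
    rw [Matrix.transpose_mul D K, hKT, Matrix.transpose_mul M Cf, hSym]
    simp only [zero_sub, Matrix.mul_neg, Matrix.neg_mul, Matrix.mul_assoc]
  have e2 : D * K * S * (D * K)ᵀ = D * (M * Cf)ᵀ * S⁻¹ * (M * Cf) * Dᵀ := by
    have : K * S = (M * Cf)ᵀ := by
      rw [hK', Matrix.mul_assoc, Matrix.nonsing_inv_mul _ hSu, Matrix.mul_one]
    rw [Matrix.mul_assoc D K S, this, Matrix.transpose_mul D K, hKT]
    simp only [Matrix.mul_assoc]
  have main : ∫ ω, ∑ i, (D.mulVec (filteredState M Cf Ce (ψf ω) (M.mulVec x + εv ω)) i) ^ 2 ∂P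
        = 1 - (D * (M * Cf)ᵀ * S⁻¹ * (M * Cf) * Dᵀ).trace := by
    have hc3 : Integrable
        (fun ω => 1 + 2 * (∑ i, D.mulVec (ψf ω) i * (D * K).mulVec (d ω) i)) P :=
      (integrable_const _).add hc2
    rw [hint, integral_add hc3 hsq.1,
      integral_add (integrable_const _) hc2, integral_const_mul, hcr.2, hsq.2, e1, e2,
      Matrix.trace_neg]
    simp only [integral_const, probReal_univ, smul_eq_mul]
    ring
  refine ⟨main, ?_⟩
  rw [main, hT]
  have hpos : ((D * (M * Cf)ᵀ) * S⁻¹ * (D * (M * Cf)ᵀ)ᵀ).PosSemidef := by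
    simpa only [Matrix.conjTranspose_eq_transpose_of_trivial] using
      hS.inv.posSemidef.mul_mul_conjTranspose_same (D * (M * Cf)ᵀ)
  linarith [hpos.trace_nonneg]
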